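/- The series ∑_{n=0}^∞ ((1/4)_n⁴ / (4n)!) · (−144)^n · (1 + 20n) converges to 8√2·π²/Γ(1/4)⁴. -/

import Mathlib

open Real Filter

/-- The Pochhammer symbol (rising factorial) `(a)_n = a (a+1) ⋯ (a+n-1)`. -/
noncomputable def poch (a : ℝ) (n : ℕ) : ℝ := (ascPochhammer ℝ n).eval a

open scoped PowerSeries
open PowerSeries (X C coeff derivative)

/-! ### Pochhammer symbols -/

lemma poch_zero (a : ℝ) : poch a 0 = 1 := by simp [poch]

lemma poch_succ (a : ℝ) (n : ℕ) : poch a (n + 1) = poch a n * (a + n) := by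
  simp [poch, ascPochhammer_succ_eval]

lemma poch_pos {a : ℝ} (ha : 0 < a) (n : ℕ) : 0 < poch a n := ascPochhammer_pos n a ha

lemma poch_one (n : ℕ) : poch 1 n = n.factorial := by
  simp [poch, ascPochhammer_eval_one]

lemma poch_succ_left (a : ℝ) (n : ℕ) : poch a (n + 1) = a * poch (a + 1) n := by
  induction n with
  | zero => simp [poch_succ, poch_zero]
  | succ n ih =>
    rw [poch_succ, ih, poch_succ]
    push_cast
    ring

lemma poch_eq_prod (a : ℝ) (n : ℕ) : poch a n = ∏ j ∈ Finset.range n, (a + j) := by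
  induction n with
  | zero => simp [poch_zero]
  | succ n ih => rw [poch_succ, ih, Finset.prod_range_succ]

/-! ### Power series converging on the unit interval -/

/-- The sum of a real power series at `x`. -/
noncomputable def evalAt (p : ℝ⟦X⟧) (x : ℝ) : ℝ := ∑' n, coeff n p * x ^ n

/-- A real power series converging absolutely on the open unit disc. -/
def ConvOnUnit (p : ℝ⟦X⟧) : Prop :=
  ∀ r : ℝ, |r| < 1 → Summable fun n => ‖coeff n p * r ^ n‖

namespace ConvOnUnit

variable {p q : ℝ⟦X⟧} {x : ℝ}

lemma summable (hp : ConvOnUnit p) (hx : |x| < 1) : Summable fun n => coeff n p * x ^ n :=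
  (hp x hx).of_norm

lemma add (hp : ConvOnUnit p) (hq : ConvOnUnit q) : ConvOnUnit (p + q) := fun r hr => by
  refine ((hp r hr).add (hq r hr)).of_nonneg_of_le (fun _ => norm_nonneg _) fun n => ?_
  simpa [add_mul] using norm_add_le (coeff n p * r ^ n) (coeff n q * r ^ n)

lemma C_mul (a : ℝ) (hp : ConvOnUnit p) : ConvOnUnit (C a * p) := fun r hr => by
  simpa [mul_assoc] using (hp r hr).mul_left |a|

lemma coeff_mul_mul_pow (p q : ℝ⟦X⟧) (x : ℝ) (n : ℕ) :
    coeff n (p * q) * x ^ n =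
      ∑ kl ∈ Finset.HasAntidiagonal.antidiagonal n,
        (coeff kl.1 p * x ^ kl.1) * (coeff kl.2 q * x ^ kl.2) := by
  rw [PowerSeries.coeff_mul, Finset.sum_mul]
  refine Finset.sum_congr rfl fun kl h => ?_
  rw [← Finset.HasAntidiagonal.mem_antidiagonal.1 h, pow_add]
  ring

lemma mul (hp : ConvOnUnit p) (hq : ConvOnUnit q) : ConvOnUnit (p * q) := fun r hr => by
  simpa only [coeff_mul_mul_pow] using
    summable_norm_sum_mul_antidiagonal_of_summable_norm (hp r hr) (hq r hr)

lemma evalAt_mul (hp : ConvOnUnit p) (hq : ConvOnUnit q) (hx : |x| < 1) :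
    evalAt (p * q) x = evalAt p x * evalAt q x := by
  simp only [evalAt, coeff_mul_mul_pow]
  exact (tsum_mul_tsum_eq_tsum_sum_antidiagonal_of_summable_norm (hp x hx) (hq x hx)).symm

lemma evalAt_add (hp : ConvOnUnit p) (hq : ConvOnUnit q) (hx : |x| < 1) :
    evalAt (p + q) x = evalAt p x + evalAt q x := by
  simp only [evalAt, map_add, add_mul]
  exact (hp.summable hx).tsum_add (hq.summable hx)

lemma X_mul (hp : ConvOnUnit p) : ConvOnUnit (X * p) := fun r hr => by
  rw [← summable_nat_add_iff 1]
  simpa [PowerSeries.coeff_succ_X_mul, pow_succ, mul_assoc] using (hp r hr).mul_right |r|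

lemma derivative (hp : ConvOnUnit p) : ConvOnUnit (derivative ℝ p) := fun r hr => by
  obtain ⟨s, hrs, hs⟩ := exists_between hr
  have hs0 : 0 < s := (abs_nonneg r).trans_lt hrs
  have h1 := (summable_nat_add_iff 1).2 (hp s (by rwa [abs_of_pos hs0]))
  have h2 : Tendsto (fun n : ℕ => ((n : ℝ) ^ 1 * (|r| / s) ^ n)) atTop (nhds 0) :=
    tendsto_pow_const_mul_const_pow_of_abs_lt_one 1
      (by rw [abs_of_nonneg (by positivity)]; exact (div_lt_one hs0).2 hrs)
  have h3 : Tendsto (fun n : ℕ => (|r| / s) ^ n) atTop (nhds 0) :=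
    tendsto_pow_atTop_nhds_zero_of_lt_one (by positivity) ((div_lt_one hs0).2 hrs)
  have h4 : ∀ᶠ n : ℕ in atTop, ((n : ℝ) ^ 1 * (|r| / s) ^ n) + (|r| / s) ^ n < s :=
    (h2.add h3).eventually (gt_mem_nhds (by simpa using hs0))
  refine summable_of_isBigO_nat h1 ?_
  refine Asymptotics.IsBigO.of_bound 1 ?_
  filter_upwards [h4] with n hn
  rw [div_pow] at hn
  have hsn : 0 < s ^ n := by positivity
  have h5 : ((n : ℝ) + 1) * |r| ^ n ≤ s ^ (n + 1) := by
    have : (n : ℝ) ^ 1 * (|r| ^ n / s ^ n) + |r| ^ n / s ^ n = (n + 1) * |r| ^ n / s ^ n := by ring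
    rw [this, div_lt_iff₀ hsn] at hn
    rw [pow_succ]; linarith
  rw [norm_norm, norm_norm, one_mul, PowerSeries.coeff_derivative, norm_mul, norm_mul, norm_mul,
    norm_pow, norm_pow, mul_assoc]
  refine mul_le_mul_of_nonneg_left ?_ (norm_nonneg _)
  rw [Real.norm_of_nonneg (by positivity : (0 : ℝ) ≤ n + 1), Real.norm_eq_abs,
    Real.norm_of_nonneg hs0.le]
  exact h5

lemma evalAt_X_mul (p : ℝ⟦X⟧) (hp : ConvOnUnit p) (hx : |x| < 1) :
    evalAt (X * p) x = x * evalAt p x := by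
  rw [evalAt, (hp.X_mul.summable hx).tsum_eq_zero_add, evalAt, ← tsum_mul_left]
  simp only [PowerSeries.coeff_succ_X_mul, pow_succ, PowerSeries.coeff_zero_X_mul, zero_mul,
    zero_add]
  exact tsum_congr fun n => by ring

lemma hasDerivAt (hp : ConvOnUnit p) (hx : |x| < 1) :
    HasDerivAt (evalAt p) (evalAt (PowerSeries.derivative ℝ p) x) x := by
  obtain ⟨s, hxs, hs⟩ := exists_between hx
  have hs0 : 0 < s := (abs_nonneg x).trans_lt hxs
  have hsa : |s| < 1 := by rwa [abs_of_pos hs0]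
  have hsum : Summable fun n : ℕ => ‖coeff n p * (n * s ^ (n - 1))‖ := by
    rw [← summable_nat_add_iff 1]
    refine (hp.derivative s hsa).congr fun n => ?_
    rw [PowerSeries.coeff_derivative]
    push_cast
    rw [mul_assoc]
  have key := hasDerivAt_tsum_of_isPreconnected (𝕜 := ℝ) (t := Set.Ioo (-s) s)
    (g := fun n y => coeff n p * y ^ n) (g' := fun n y => coeff n p * (n * y ^ (n - 1)))
    (y₀ := 0) (y := x) hsum isOpen_Ioo isPreconnected_Ioo
    (fun n y _ => (hasDerivAt_pow n y).const_mul _)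
    (fun n y hy => by
      rw [norm_mul, norm_mul, norm_mul, norm_mul, norm_pow, norm_pow]
      have : ‖y‖ ≤ ‖s‖ := by
        rw [Real.norm_eq_abs, Real.norm_of_nonneg hs0.le]
        exact (abs_lt.2 hy).le
      gcongr)
    ⟨by linarith, hs0⟩ (hp.summable (by simp)) (abs_lt.1 hxs)
  convert! key using 1
  have h0 : Summable fun n : ℕ => coeff n p * (n * x ^ (n - 1)) := by
    rw [← summable_nat_add_iff 1]
    refine (hp.derivative.summable hx).congr fun n => ?_
    rw [PowerSeries.coeff_derivative]
    push_cast
    rw [mul_assoc]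
  rw [h0.tsum_eq_zero_add, evalAt]
  simp only [Nat.cast_zero, zero_mul, mul_zero, zero_add]
  refine tsum_congr fun n => ?_
  rw [PowerSeries.coeff_derivative]
  push_cast
  rw [mul_assoc]

end ConvOnUnit

lemma evalAt_zero (p : ℝ⟦X⟧) : evalAt p 0 = coeff 0 p := by
  rw [evalAt, tsum_eq_single 0 (fun n hn => by simp [hn])]
  simp

lemma evalAt_C_mul (a : ℝ) (p : ℝ⟦X⟧) (x : ℝ) : evalAt (C a * p) x = a * evalAt p x := by
  simp [evalAt, mul_assoc, tsum_mul_left]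

/-! ### The Gauss hypergeometric series -/

/-- The Euler operator `X d/dX` on power series. -/
noncomputable def theta (p : ℝ⟦X⟧) : ℝ⟦X⟧ := X * derivative ℝ p

lemma theta_mul (p q : ℝ⟦X⟧) : theta (p * q) = theta p * q + p * theta q := by
  simp only [theta, Derivation.leibniz, smul_eq_mul]
  ring

lemma theta_add (p q : ℝ⟦X⟧) : theta (p + q) = theta p + theta q := by
  simp only [theta, map_add, mul_add]

lemma theta_C_mul (a : ℝ) (p : ℝ⟦X⟧) : theta (C a * p) = C a * theta p := by
  rw [theta_mul]
  simp [theta]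

lemma theta_X_mul (p : ℝ⟦X⟧) : theta (X * p) = X * p + X * theta p := by
  rw [theta_mul]
  simp [theta]

lemma coeff_theta (p : ℝ⟦X⟧) (n : ℕ) : coeff n (theta p) = n * coeff n p := by
  cases n with
  | zero => simp [theta]
  | succ n =>
    rw [theta, PowerSeries.coeff_succ_X_mul, PowerSeries.coeff_derivative]
    push_cast
    ring

/-- The Gauss hypergeometric series `₂F₁(a, b; c; X)`. -/
noncomputable def hyp (a b c : ℝ) : ℝ⟦X⟧ :=
  PowerSeries.mk fun n => poch a n * poch b n / (poch c n * n.factorial)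

/-- The hypergeometric differential equation, written with the Euler operator. -/
def HypODE (a b c : ℝ) (p : ℝ⟦X⟧) : Prop :=
  theta (theta p) + C (c - 1) * theta p =
    X * (theta (theta p) + C (a + b) * theta p + C (a * b) * p)

lemma coeff_hyp (a b c : ℝ) (n : ℕ) :
    coeff n (hyp a b c) = poch a n * poch b n / (poch c n * n.factorial) := by
  simp [hyp]

lemma coeff_hyp_succ {a b c : ℝ} (hc : 0 < c) (n : ℕ) :
    coeff (n + 1) (hyp a b c) = (a + n) * (b + n) / ((c + n) * (n + 1)) * coeff n (hyp a b c) := by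
  have := (poch_pos hc n).ne'
  rw [coeff_hyp, coeff_hyp, poch_succ, poch_succ, poch_succ, Nat.factorial_succ]
  push_cast
  have : c + n ≠ 0 := by positivity
  field_simp

lemma coeff_hyp_pos {a b c : ℝ} (ha : 0 < a) (hb : 0 < b) (hc : 0 < c) (n : ℕ) :
    0 < coeff n (hyp a b c) := by
  rw [coeff_hyp]
  have := poch_pos ha n
  have := poch_pos hb n
  have := poch_pos hc n
  positivity

lemma hypODE_hyp {a b c : ℝ} (hc : 0 < c) : HypODE a b c (hyp a b c) := by
  ext n
  cases n with
  | zero =>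
    rw [PowerSeries.coeff_zero_X_mul]
    simp only [map_add (coeff _), PowerSeries.coeff_C_mul, coeff_theta, Nat.cast_zero, zero_mul,
      mul_zero, add_zero]
  | succ n =>
    rw [PowerSeries.coeff_succ_X_mul]
    simp only [map_add (coeff _), PowerSeries.coeff_C_mul, coeff_theta, coeff_hyp_succ hc]
    have : c + n ≠ 0 := by positivity
    push_cast
    field_simp
    ring

lemma HypODE.eq_hyp {a b c : ℝ} (hc : 0 < c) {p : ℝ⟦X⟧} (hp : HypODE a b c p)
    (h0 : coeff 0 p = 1) : p = hyp a b c := by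
  ext n
  induction n with
  | zero => rw [h0, coeff_hyp]; simp [poch_zero]
  | succ n ih =>
    have h := congrArg (coeff (n + 1)) hp
    rw [PowerSeries.coeff_succ_X_mul] at h
    simp only [map_add (coeff _), PowerSeries.coeff_C_mul, coeff_theta] at h
    rw [coeff_hyp_succ hc, ← ih]
    have : c + n ≠ 0 := by positivity
    push_cast at h
    field_simp
    linear_combination h

/-- The first-order equation of the binomial series `₂F₁(a, 1; 1; X) = (1 - X) ^ (-a)`. -/
lemma theta_hyp_one (a : ℝ) : theta (hyp a 1 1) = X * (theta (hyp a 1 1) + C a * hyp a 1 1) := by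
  ext n
  cases n with
  | zero =>
    rw [PowerSeries.coeff_zero_X_mul]
    simp only [coeff_theta, Nat.cast_zero, zero_mul]
  | succ n =>
    rw [PowerSeries.coeff_succ_X_mul]
    simp only [map_add (coeff _), PowerSeries.coeff_C_mul, coeff_theta, coeff_hyp_succ one_pos]
    push_cast
    have : (1 : ℝ) + n ≠ 0 := by positivity
    field_simp
    ring

/-- Euler's transformation of the Gauss hypergeometric series. -/
theorem hyp_euler {a b c : ℝ} (hc : 0 < c) :
    hyp (c - a - b) 1 1 * hyp a b c = hyp (c - a) (c - b) c := by
  refine HypODE.eq_hyp hc ?_ ?_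
  · have hB := theta_hyp_one (c - a - b)
    have hG := hypODE_hyp (a := a) (b := b) hc
    rw [HypODE] at hG ⊢
    set B := hyp (c - a - b) 1 1
    set G := hyp a b c
    have hB' := congrArg theta hB
    simp only [theta_add, theta_C_mul, theta_X_mul] at hB'
    simp only [theta_mul, theta_add]
    simp only [map_add, map_sub, map_mul, map_one] at hB hB' hG ⊢
    linear_combination G * hB' + (2 * theta G + (C c - 1) * G) * hB + B * hG
  · simp [PowerSeries.coeff_mul, coeff_hyp, poch_zero]

/-- Clausen's formula for the square of `₂F₁(a, b; a + b + 1/2; X)` at `a = b = 1/8`. -/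
lemma coeff_hyp_sq (n : ℕ) :
    coeff n (hyp (1 / 8) (1 / 8) (3 / 4) * hyp (1 / 8) (1 / 8) (3 / 4)) =
      poch (1 / 4) n ^ 4 * 256 ^ n / (4 * n).factorial := by
  have hE := hypODE_hyp (a := 1 / 8) (b := 1 / 8) (c := 3 / 4) (by norm_num)
  have h0 : coeff 0 (hyp (1 / 8) (1 / 8) (3 / 4)) = 1 := by simp [coeff_hyp, poch_zero]
  rw [HypODE] at hE
  set y := hyp (1 / 8) (1 / 8) (3 / 4)
  have hE' := congrArg theta hE
  simp only [theta_add, theta_C_mul, theta_X_mul] at hE'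
  have hC (a : ℝ) (m : ℤ) (h : a = m * (-1 / 64)) : C a = (m : ℝ⟦X⟧) * C (-1 / 64) := by
    rw [h, map_mul, map_intCast]
  have hk : (1 : ℝ⟦X⟧) = ((-64 : ℤ) : ℝ⟦X⟧) * C (-1 / 64) := by
    rw [← hC 1 (-64) (by norm_num), map_one]
  have key : theta (theta (theta (y * y))) + C (-3 / 4) * theta (theta (y * y))
      + C (1 / 8) * theta (y * y) =
      X * (theta (theta (theta (y * y))) + C (3 / 4) * theta (theta (y * y))
        + C (3 / 16) * theta (y * y) + C (1 / 64) * (y * y)) := by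
    rw [hC (3 / 4 - 1) 16 (by norm_num), hC (1 / 8 + 1 / 8) (-16) (by norm_num),
      hC (1 / 8 * (1 / 8)) (-1) (by norm_num)] at hE hE'
    rw [hC (-3 / 4) 48 (by norm_num), hC (1 / 8) (-8) (by norm_num), hC (3 / 4) (-48) (by norm_num),
      hC (3 / 16) (-12) (by norm_num), hC (1 / 64) (-1) (by norm_num)]
    simp only [theta_mul, theta_add]
    generalize C (-1 / 64) = k at *
    push_cast at *
    linear_combination 2 * y * hE' + (6 * theta y - y) * hE + (1 + X) * y * theta (theta y) * hk
  clear_value y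
  induction n with
  | zero => simp [PowerSeries.coeff_mul, poch_zero, h0]
  | succ n ih =>
    have h := congrArg (coeff (n + 1)) key
    rw [PowerSeries.coeff_succ_X_mul] at h
    simp only [map_add (coeff _), PowerSeries.coeff_C_mul, coeff_theta] at h
    rw [ih] at h
    have h4 : ((4 * (n + 1)).factorial : ℝ) =
        (4 * n + 4) * ((4 * n + 3) * ((4 * n + 2) * ((4 * n + 1) * (4 * n).factorial))) := by
      rw [show 4 * (n + 1) = 4 * n + 1 + 1 + 1 + 1 by ring]
      simp only [Nat.factorial_succ]
      push_cast
      ring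
    have h5 : ((n : ℝ) + 1) * (4 * n + 2) * (4 * n + 3) ≠ 0 := by positivity
    refine mul_left_cancel₀ h5 ?_
    rw [h4, poch_succ]
    push_cast at h
    have h6 : (4 * n + 1 : ℝ) ≠ 0 := by positivity
    have h7 : (4 * n + 2 : ℝ) ≠ 0 := by positivity
    have h8 : (4 * n + 3 : ℝ) ≠ 0 := by positivity
    have h9 : ((4 * n).factorial : ℝ) ≠ 0 := by positivity
    trans poch (1 / 4) n ^ 4 * 256 ^ n / (4 * n).factorial * (1 / 4 + n) ^ 3 * 16
    · linear_combination 16 * h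
    · field_simp
      ring

lemma convOnUnit_hyp {a b c : ℝ} (ha : 0 < a) (hb : 0 < b) (hc : 0 < c) :
    ConvOnUnit (hyp a b c) := fun r hr => by
  rcases eq_or_ne r 0 with rfl | hr0
  · refine summable_of_ne_finset_zero (s := {0}) fun n hn => ?_
    simp [show n ≠ 0 by simpa using hn]
  have hlim : Tendsto (fun n : ℕ => (a + n) / (1 * n + c) * ((b + n) / (1 * n + 1)) * |r|) atTop
      (nhds (1 / 1 * (1 / 1) * |r|)) := by
    have h (x y : ℝ) : Tendsto (fun n : ℕ => (x + n) / (1 * n + y)) atTop (nhds (1 / 1)) := by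
      simpa [add_comm] using tendsto_add_mul_div_add_mul_atTop_nhds x y 1 (one_ne_zero (α := ℝ))
    exact ((h a c).mul (h b 1)).mul_const _
  refine summable_of_ratio_test_tendsto_lt_one (l := |r|) hr
    (Eventually.of_forall fun n => by
      simpa [hr0, -PowerSeries.coeff_zero_eq_constantCoeff] using (coeff_hyp_pos ha hb hc n).ne') ?_
  rw [div_one, one_mul, one_mul] at hlim
  refine hlim.congr fun n => ?_
  have h1 := coeff_hyp_pos ha hb hc n
  have h2 : 0 < c + n := by positivity
  simp only [norm_norm, norm_mul, norm_pow]
  rw [Real.norm_of_nonneg h1.le, Real.norm_of_nonneg (coeff_hyp_pos ha hb hc _).le,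
    coeff_hyp_succ hc, Real.norm_eq_abs]
  have : |r| ≠ 0 := abs_ne_zero.2 hr0
  field_simp
  ring

/-- The hypergeometric equation satisfied by the sum of the series. -/
lemma hyp_evalAt_ode {a b c x : ℝ} (ha : 0 < a) (hb : 0 < b) (hc : 0 < c) (hx : |x| < 1)
    (hx0 : x ≠ 0) :
    x * (1 - x) * evalAt (derivative ℝ (derivative ℝ (hyp a b c))) x =
      ((a + b + 1) * x - c) * evalAt (derivative ℝ (hyp a b c)) x +
        a * b * evalAt (hyp a b c) x := by
  have hp := convOnUnit_hyp ha hb hc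
  have h := hypODE_hyp (a := a) (b := b) hc
  set p := hyp a b c
  have h1 := hp.derivative
  have h2 := h1.derivative
  have ht : theta (theta p) = X * derivative ℝ p + X * (X * derivative ℝ (derivative ℝ p)) := by
    rw [theta, theta, Derivation.leibniz, PowerSeries.derivative_X]
    simp only [smul_eq_mul]
    ring
  rw [HypODE, ht, theta] at h
  have key := congrArg (evalAt · x) h
  have c1 := h1.X_mul
  have c2 := h2.X_mul.X_mul
  have e1 := ConvOnUnit.evalAt_X_mul _ h1 hx
  have e2 := ConvOnUnit.evalAt_X_mul _ h2.X_mul hx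
  have e3 := ConvOnUnit.evalAt_X_mul _ h2 hx
  have e4 := ConvOnUnit.evalAt_X_mul _
    (((c1.add c2).add (c1.C_mul (a + b))).add (hp.C_mul (a * b))) hx
  rw [e4, ConvOnUnit.evalAt_add ((c1.add c2).add (c1.C_mul (a + b))) (hp.C_mul (a * b)) hx,
    ConvOnUnit.evalAt_add (c1.add c2) (c1.C_mul (a + b)) hx,
    ConvOnUnit.evalAt_add (c1.add c2) (c1.C_mul (c - 1)) hx,
    ConvOnUnit.evalAt_add c1 c2 hx, evalAt_C_mul, evalAt_C_mul, evalAt_C_mul, e1, e2, e3] at key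
  refine mul_left_cancel₀ hx0 ?_
  linear_combination key

lemma evalAt_pos {p : ℝ⟦X⟧} {x : ℝ} (hp : ConvOnUnit p) (hpos : ∀ n, 0 < coeff n p) (h0 : 0 ≤ x)
    (h1 : x < 1) : 0 < evalAt p x :=
  (hp.summable (by rwa [abs_of_nonneg h0])).tsum_pos
    (fun n => mul_nonneg (hpos n).le (by positivity)) 0 (by simpa using hpos 0)

/-- A function on an interval with vanishing derivative in the interior is constant. -/
lemma eq_of_hasDerivAt_zero {f : ℝ → ℝ} {s : Set ℝ} (hs : Convex ℝ s) (hf : ContinuousOn f s)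
    (hf' : ∀ x ∈ interior s, HasDerivAt f 0 x) {x y : ℝ} (hx : x ∈ s) (hy : y ∈ s) : f x = f y := by
  have hd : DifferentiableOn ℝ f (interior s) := fun x hx =>
    (hf' x hx).differentiableAt.differentiableWithinAt
  have h1 := monotoneOn_of_deriv_nonneg hs hf hd fun x hx => (hf' x hx).deriv.ge
  have h2 := antitoneOn_of_deriv_nonpos hs hf hd fun x hx => (hf' x hx).deriv.le
  rcases le_total x y with h | h
  · exact le_antisymm (h1 hx hy h) (h2 hx hy h)
  · exact le_antisymm (h2 hy hx h) (h1 hy hx h)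

/-- The binomial series. -/
lemma evalAt_hyp_one {a x : ℝ} (ha : 0 < a) (hx : |x| < 1) :
    evalAt (hyp a 1 1) x = (1 - x) ^ (-a) := by
  have hp := convOnUnit_hyp ha one_pos one_pos
  have h := theta_hyp_one a
  set p := hyp a 1 1 with hpdef
  have hODE : derivative ℝ p = X * derivative ℝ p + C a * p :=
    mul_left_cancel₀ PowerSeries.X_ne_zero (by simpa [theta] using h)
  have hD (y : ℝ) (hy : |y| < 1) :
      (1 - y) * evalAt (derivative ℝ p) y = a * evalAt p y := by
    have := congrArg (evalAt · y) hODE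
    rw [ConvOnUnit.evalAt_add hp.derivative.X_mul (hp.C_mul a) hy, evalAt_C_mul,
      ConvOnUnit.evalAt_X_mul _ hp.derivative hy] at this
    linear_combination this
  have hder (y : ℝ) (hy : |y| < 1) : HasDerivAt (fun y => evalAt p y * (1 - y) ^ a) 0 y := by
    have hy1 : 0 < 1 - y := by linarith [(abs_lt.1 hy).2]
    have h1 := (hp.hasDerivAt hy).mul
      (((hasDerivAt_id y).const_sub 1).rpow_const (p := a) (Or.inl hy1.ne'))
    refine h1.congr_deriv ?_
    have h2 : (1 - y) ^ a = (1 - y) * (1 - y) ^ (a - 1) := by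
      rw [Real.rpow_sub_one hy1.ne']; field_simp
    simp only [id]
    rw [h2]
    linear_combination (1 - y) ^ (a - 1) * hD y hy
  have hIoo (y : ℝ) (hy : y ∈ Set.Ioo (-1 : ℝ) 1) : |y| < 1 := abs_lt.2 hy
  have := eq_of_hasDerivAt_zero (s := Set.Ioo (-1) 1) (convex_Ioo _ _)
    (fun y hy => (hder y (hIoo y hy)).continuousAt.continuousWithinAt)
    (fun y hy => hder y (hIoo y (interior_subset hy))) (abs_lt.1 hx) (y := 0) (by norm_num)
  have hx1 : 0 < 1 - x := by linarith [(abs_lt.1 hx).2]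
  simp only [evalAt_zero, sub_zero, Real.one_rpow, mul_one, hpdef, coeff_hyp, poch_zero] at this
  rw [Real.rpow_neg hx1.le]
  refine eq_inv_of_mul_eq_one_left ?_
  simpa using this

/-- If the ratio of coefficients tends to `L` and the denominator series blows up at `1`, then the
ratio of the sums tends to `L`. -/
lemma tendsto_evalAt_div {p q : ℝ⟦X⟧} {L : ℝ} (hp : ConvOnUnit p) (hq : ConvOnUnit q)
    (hpos : ∀ n, 0 < coeff n q) (hL : Tendsto (fun n => coeff n p / coeff n q) atTop (nhds L))
    (hinf : Tendsto (evalAt q) (nhdsWithin 1 (Set.Iio 1)) atTop) :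
    Tendsto (fun x => evalAt p x / evalAt q x) (nhdsWithin 1 (Set.Iio 1)) (nhds L) := by
  rw [Metric.tendsto_nhds]
  intro ε hε
  obtain ⟨N, hN⟩ := Metric.tendsto_atTop.1 hL (ε / 2) (by positivity)
  set K := ∑ n ∈ Finset.range N, |coeff n p - L * coeff n q| with hK
  have hK0 : 0 ≤ K := Finset.sum_nonneg fun _ _ => abs_nonneg _
  filter_upwards [hinf.eventually_gt_atTop (2 * K / ε), self_mem_nhdsWithin,
    nhdsWithin_le_nhds (Ioi_mem_nhds (zero_lt_one' ℝ))] with x hx hx1 hx0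
  have hx1 : x < 1 := hx1
  have hx0 : 0 < x := hx0
  have hxa : |x| < 1 := by rwa [abs_of_pos hx0]
  have hq0 := evalAt_pos hq hpos hx0.le hx1
  have hs : Summable fun n => |coeff n p - L * coeff n q| * x ^ n := by
    refine ((hp x hxa).add ((hq x hxa).mul_left |L|)).of_nonneg_of_le
      (fun n => by positivity) fun n => ?_
    have := abs_sub (coeff n p) (L * coeff n q)
    simp only [norm_mul, norm_pow, Real.norm_eq_abs, abs_mul, abs_of_pos hx0] at this ⊢
    nlinarith [pow_pos hx0 n]
  have hbound : |evalAt p x - L * evalAt q x| ≤ K + ε / 2 * evalAt q x := by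
    have e1 : evalAt p x - L * evalAt q x = ∑' n, (coeff n p - L * coeff n q) * x ^ n := by
      rw [evalAt, evalAt, ← tsum_mul_left,
        ← (hp.summable hxa).tsum_sub ((hq.summable hxa).mul_left L)]
      exact tsum_congr fun n => by ring
    have hs' : Summable fun n => ‖(coeff n p - L * coeff n q) * x ^ n‖ := by
      simpa [abs_mul, abs_of_pos hx0] using hs
    rw [e1, ← Real.norm_eq_abs]
    refine (norm_tsum_le_tsum_norm hs').trans ?_
    have hle : ∀ n, ‖(coeff n p - L * coeff n q) * x ^ n‖ ≤
        (if n < N then |coeff n p - L * coeff n q| else 0) + ε / 2 * (coeff n q * x ^ n) := by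
      intro n
      have hqn := hpos n
      have hxn : 0 < x ^ n := by positivity
      rw [norm_mul, Real.norm_eq_abs, Real.norm_of_nonneg hxn.le]
      split_ifs with h
      · have : x ^ n ≤ 1 := pow_le_one₀ hx0.le hx1.le
        have : |coeff n p - L * coeff n q| * x ^ n ≤ |coeff n p - L * coeff n q| :=
          mul_le_of_le_one_right (abs_nonneg _) this
        have : 0 < ε / 2 * (coeff n q * x ^ n) := by positivity
        linarith
      · have h1 := hN n (not_lt.1 h)
        rw [Real.dist_eq, div_sub' hqn.ne', abs_div, abs_of_pos hqn, div_lt_iff₀ hqn,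
          mul_comm (coeff n q)] at h1
        rw [zero_add, ← mul_assoc]
        exact mul_le_mul_of_nonneg_right h1.le hxn.le
    have hf : Summable fun n => if n < N then |coeff n p - L * coeff n q| else 0 :=
      summable_of_ne_finset_zero (s := Finset.range N) fun n hn => by
        rw [if_neg (by simpa using hn)]
    have hg := (hq.summable hxa).mul_left (ε / 2)
    refine (hs'.tsum_le_tsum hle (hf.add hg)).trans (le_of_eq ?_)
    rw [hf.tsum_add hg, tsum_mul_left, ← evalAt, hK,
      tsum_eq_sum (s := Finset.range N) fun n hn => by rw [if_neg (by simpa using hn)]]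
    congr 1
    exact Finset.sum_congr rfl fun n hn => if_pos (Finset.mem_range.1 hn)
  rw [Real.dist_eq, div_sub' hq0.ne', abs_div, abs_of_pos hq0, div_lt_iff₀ hq0,
    mul_comm (evalAt q x)]
  rw [div_lt_iff₀ hε] at hx
  linarith

/-! ### Limits of ratios of Pochhammer symbols and the Gamma function -/

lemma tendsto_poch_ratio {a b c d : ℝ} (ha : 0 < a) (hb : 0 < b) (hc : 0 < c) (hd : 0 < d)
    (h : a + b = c + d) :
    Tendsto (fun n => poch a n * poch b n / (poch c n * poch d n)) atTop
      (nhds (Real.Gamma c * Real.Gamma d / (Real.Gamma a * Real.Gamma b))) := by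
  rw [← tendsto_add_atTop_iff_nat 1]
  have key := ((Real.GammaSeq_tendsto_Gamma c).mul (Real.GammaSeq_tendsto_Gamma d)).div
    ((Real.GammaSeq_tendsto_Gamma a).mul (Real.GammaSeq_tendsto_Gamma b))
    (mul_pos (Real.Gamma_pos_of_pos ha) (Real.Gamma_pos_of_pos hb)).ne'
  refine key.congr' ?_
  filter_upwards [eventually_gt_atTop 0] with n hn
  have hn0 : (0 : ℝ) < n := by exact_mod_cast hn
  have e : (n : ℝ) ^ a * (n : ℝ) ^ b = (n : ℝ) ^ c * (n : ℝ) ^ d := by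
    rw [← Real.rpow_add hn0, ← Real.rpow_add hn0, h]
  simp only [Pi.div_apply, Real.GammaSeq, ← poch_eq_prod]
  have := poch_pos ha (n + 1)
  have := poch_pos hb (n + 1)
  have := poch_pos hc (n + 1)
  have := poch_pos hd (n + 1)
  have : 0 < (n : ℝ) ^ a := by positivity
  have : 0 < (n : ℝ) ^ b := by positivity
  have : (0 : ℝ) < n.factorial := by positivity
  field_simp
  linear_combination -e

lemma poch_three_mul (s : ℝ) (n : ℕ) :
    poch (3 * s) (3 * n) = 27 ^ n * (poch s n * poch (s + 1 / 3) n * poch (s + 2 / 3) n) := by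
  induction n with
  | zero => simp [poch_zero]
  | succ n ih =>
    rw [show 3 * (n + 1) = 3 * n + 1 + 1 + 1 by ring]
    simp only [poch_succ, ih]
    push_cast
    ring

/-- The multiplication formula for `Γ` with factor three, up to the value at `s = 1 / 3`. -/
lemma Gamma_mul_three {s : ℝ} (hs : 0 < s) :
    Real.Gamma s * Real.Gamma (s + 1 / 3) * Real.Gamma (s + 2 / 3) =
      3 ^ (1 - 3 * s) * (Real.Gamma (1 / 3) * Real.Gamma (2 / 3)) * Real.Gamma (3 * s) := by
  set R : ℕ → ℝ := fun n => n * n.factorial ^ 3 * 27 ^ (n + 1) / (3 * n + 2).factorial with hR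
  have hlim {t : ℝ} (ht : 0 < t) :
      Tendsto (fun n : ℕ => R n * ((n : ℝ) / (3 * n + 2)) ^ (3 * t)) atTop
        (nhds (Real.Gamma t * Real.Gamma (t + 1 / 3) * Real.Gamma (t + 2 / 3) /
          Real.Gamma (3 * t))) := by
    have hsub : Tendsto (fun n : ℕ => 3 * n + 2) atTop atTop :=
      tendsto_atTop_mono (fun n => by simp only [id]; omega) tendsto_id
    have key := (((Real.GammaSeq_tendsto_Gamma t).mul
      (Real.GammaSeq_tendsto_Gamma (t + 1 / 3))).mul
      (Real.GammaSeq_tendsto_Gamma (t + 2 / 3))).div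
      ((Real.GammaSeq_tendsto_Gamma (3 * t)).comp hsub)
      (Real.Gamma_pos_of_pos (by positivity)).ne'
    refine key.congr' ?_
    filter_upwards [eventually_gt_atTop 0] with n hn
    have hn0 : (0 : ℝ) < n := by exact_mod_cast hn
    have e : (n : ℝ) ^ t * (n : ℝ) ^ (t + 1 / 3) * (n : ℝ) ^ (t + 2 / 3) =
        (n : ℝ) ^ (3 * t) * n := by
      rw [← Real.rpow_add hn0, ← Real.rpow_add hn0, ← Real.rpow_add_one hn0.ne']
      congr 1
      ring
    simp only [Pi.div_apply, Function.comp, Real.GammaSeq, ← poch_eq_prod, hR]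
    rw [show 3 * n + 2 + 1 = 3 * (n + 1) by ring, poch_three_mul,
      Real.div_rpow hn0.le (by positivity)]
    push_cast
    have := poch_pos ht (n + 1)
    have := poch_pos (show 0 < t + 1 / 3 by positivity) (n + 1)
    have := poch_pos (show 0 < t + 2 / 3 by positivity) (n + 1)
    have : 0 < (3 * (n : ℝ) + 2) ^ (3 * t) := by positivity
    clear key
    generalize t + 1 / 3 = a at *
    generalize t + 2 / 3 = b at *
    generalize 3 * t = c at *
    field_simp
    linear_combination e
  have h1 := hlim hs
  have h2 := hlim (t := 1 / 3) (by norm_num)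
  have hq : Tendsto (fun n : ℕ => (n : ℝ) / (3 * n + 2)) atTop (nhds (1 / 3)) := by
    simpa [add_comm] using
      tendsto_add_mul_div_add_mul_atTop_nhds (0 : ℝ) 2 1 (three_ne_zero (α := ℝ))
  have h3 := h2.mul (hq.rpow_const (p := 3 * s - 1) (Or.inl (by norm_num)))
  have h4 := tendsto_nhds_unique h1 (h3.congr' (by
    filter_upwards [eventually_gt_atTop 0] with n hn
    have hn0 : (0 : ℝ) < n := by exact_mod_cast hn
    rw [mul_assoc, ← Real.rpow_add (by positivity)]
    congr 2
    ring))
  rw [div_eq_iff (Real.Gamma_pos_of_pos (by positivity)).ne'] at h4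
  rw [h4, one_div, Real.inv_rpow (by norm_num), ← Real.rpow_neg (by norm_num), neg_sub,
    show (3 : ℝ)⁻¹ + 3⁻¹ = 2 / 3 by norm_num, show (3 : ℝ)⁻¹ + 2 / 3 = 1 by norm_num,
    show (3 : ℝ) * 3⁻¹ = 1 by norm_num, Real.Gamma_one]
  ring

/-! ### A sextic transformation between two hypergeometric functions -/

section Transformation

/-- Abbreviation for `₂F₁(1/8, 1/8; 3/4; X)`. -/
noncomputable abbrev hypF : ℝ⟦X⟧ := hyp (1 / 8) (1 / 8) (3 / 4)

/-- Abbreviation for `₂F₁(1/12, 1/12; 1/2; X)`. -/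
noncomputable abbrev hypG : ℝ⟦X⟧ := hyp (1 / 12) (1 / 12) (1 / 2)

/-- The argument of `hypF` in the transformation. -/
noncomputable def argF (s : ℝ) : ℝ := -((s - 1) ^ 2 / (4 * s))

/-- The argument of `hypG` in the transformation. -/
noncomputable def argG (s : ℝ) : ℝ := (s - 1) * (s + 8) ^ 2 / (27 * s ^ 2)

lemma convOnUnit_hypF : ConvOnUnit hypF := convOnUnit_hyp (by norm_num) (by norm_num) (by norm_num)

lemma convOnUnit_hypG : ConvOnUnit hypG := convOnUnit_hyp (by norm_num) (by norm_num) (by norm_num)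

variable {s : ℝ}

lemma abs_argF_lt (h1 : 1 ≤ s) (h4 : s ≤ 4) : |argF s| < 1 := by
  rw [argF, abs_neg, abs_of_nonneg (by positivity), div_lt_one (by positivity)]
  nlinarith

lemma one_sub_argG (h1 : 1 ≤ s) : 1 - argG s = (4 - s) ^ 3 / (27 * s ^ 2) := by
  have : s ≠ 0 := by positivity
  rw [argG]
  field_simp
  ring

lemma argG_nonneg (h1 : 1 ≤ s) : 0 ≤ argG s := by
  have : 0 ≤ s - 1 := by linarith
  rw [argG]
  positivity

lemma argG_lt_one (h1 : 1 ≤ s) (h4 : s < 4) : argG s < 1 := by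
  have : 0 < 4 - s := by linarith
  have : 0 < 1 - argG s := by
    rw [one_sub_argG h1]
    positivity
  linarith

lemma abs_argG_lt (h1 : 1 ≤ s) (h4 : s < 4) : |argG s| < 1 := by
  rw [abs_of_nonneg (argG_nonneg h1)]
  exact argG_lt_one h1 h4

lemma hasDerivAt_argF (h : s ≠ 0) : HasDerivAt argF (-((s ^ 2 - 1) / (4 * s ^ 2))) s := by
  have := ((((hasDerivAt_id s).sub_const 1).pow 2).div ((hasDerivAt_id s).const_mul 4)
    (by simpa using h)).neg
  refine this.congr_deriv ?_
  simp
  field_simp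
  ring

lemma hasDerivAt_argG (h : s ≠ 0) :
    HasDerivAt argG ((s - 4) ^ 2 * (s + 8) / (27 * s ^ 3)) s := by
  have := (((hasDerivAt_id s).sub_const 1).mul (((hasDerivAt_id s).add_const 8).pow 2)).div
    (((hasDerivAt_id s).pow 2).const_mul 27) (by simpa using h)
  refine this.congr_deriv ?_
  simp
  field_simp
  ring

lemma hasDerivAt_deriv_argF (h : s ≠ 0) :
    HasDerivAt (fun s => -((s ^ 2 - 1) / (4 * s ^ 2))) (-(1 / (2 * s ^ 3))) s := by
  have := ((((hasDerivAt_id s).pow 2).sub_const 1).div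
    (((hasDerivAt_id s).pow 2).const_mul 4) (by simpa using h)).neg
  refine this.congr_deriv ?_
  simp
  field_simp
  ring

lemma hasDerivAt_deriv_argG (h : s ≠ 0) :
    HasDerivAt (fun s => (s - 4) ^ 2 * (s + 8) / (27 * s ^ 3)) (32 * (s - 4) / (9 * s ^ 4)) s := by
  have := ((((hasDerivAt_id s).sub_const 4).pow 2).mul ((hasDerivAt_id s).add_const 8)).div
    (((hasDerivAt_id s).pow 3).const_mul 27) (by simpa using h)
  refine this.congr_deriv ?_
  simp
  field_simp
  ring

/-- The function `₂F₁(1/8, 1/8; 3/4; ·)` in the parameter `s`. -/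
noncomputable def funF (s : ℝ) : ℝ := evalAt hypF (argF s)

/-- The derivative of `funF`. -/
noncomputable def funF' (s : ℝ) : ℝ :=
  evalAt (derivative ℝ hypF) (argF s) * (-((s ^ 2 - 1) / (4 * s ^ 2)))

/-- The function `₂F₁(1/12, 1/12; 1/2; ·)` in the parameter `s`. -/
noncomputable def funG (s : ℝ) : ℝ := evalAt hypG (argG s)

/-- The derivative of `funG`. -/
noncomputable def funG' (s : ℝ) : ℝ :=
  evalAt (derivative ℝ hypG) (argG s) * ((s - 4) ^ 2 * (s + 8) / (27 * s ^ 3))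

lemma hasDerivAt_funF (h1 : 1 ≤ s) (h4 : s ≤ 4) : HasDerivAt funF (funF' s) s :=
  (convOnUnit_hypF.hasDerivAt (abs_argF_lt h1 h4)).comp s (hasDerivAt_argF (by positivity))

lemma hasDerivAt_funG (h1 : 1 ≤ s) (h4 : s < 4) : HasDerivAt funG (funG' s) s :=
  (convOnUnit_hypG.hasDerivAt (abs_argG_lt h1 h4)).comp s (hasDerivAt_argG (by positivity))

lemma differentiableAt_funF' (h1 : 1 ≤ s) (h4 : s ≤ 4) : DifferentiableAt ℝ funF' s :=
  (((convOnUnit_hypF.derivative.hasDerivAt (abs_argF_lt h1 h4)).comp s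
    (hasDerivAt_argF (by positivity))).mul (hasDerivAt_deriv_argF (by positivity))).differentiableAt

lemma differentiableAt_funG' (h1 : 1 ≤ s) (h4 : s < 4) : DifferentiableAt ℝ funG' s :=
  (((convOnUnit_hypG.derivative.hasDerivAt (abs_argG_lt h1 h4)).comp s
    (hasDerivAt_argG (by positivity))).mul (hasDerivAt_deriv_argG (by positivity))).differentiableAt

lemma hasDerivAt_funF' (h1 : 1 < s) (h4 : s < 4) :
    HasDerivAt funF' (-((5 * s - 3) / (4 * s * (s - 1))) * funF' s -
      (1 / (64 * s ^ 2)) * funF s) s := by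
  have hs : s ≠ 0 := by positivity
  have hs1 : s - 1 ≠ 0 := by linarith
  have hs2 : s + 1 ≠ 0 := by positivity
  have hz : argF s ≠ 0 := by
    rw [argF]
    exact neg_ne_zero.2 (by positivity)
  have ode := hyp_evalAt_ode (a := 1 / 8) (b := 1 / 8) (c := 3 / 4) (by norm_num) (by norm_num)
    (by norm_num) (abs_argF_lt h1.le h4.le) hz
  refine (((convOnUnit_hypF.derivative.hasDerivAt (abs_argF_lt h1.le h4.le)).comp s
    (hasDerivAt_argF hs)).mul (hasDerivAt_deriv_argF hs)).congr_deriv ?_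
  rw [funF', funF, Function.comp]
  generalize evalAt (derivative ℝ (derivative ℝ hypF)) (argF s) = y2 at *
  generalize evalAt (derivative ℝ hypF) (argF s) = y1 at *
  generalize evalAt hypF (argF s) = y0 at *
  have hy2 : y2 = (((1 / 8 + 1 / 8 + 1) * argF s - 3 / 4) * y1 + 1 / 8 * (1 / 8) * y0) /
      (-((s - 1) ^ 2 * (s + 1) ^ 2 / (16 * s ^ 2))) := by
    rw [eq_div_iff (neg_ne_zero.2 (by positivity)), ← ode, argF]
    field_simp
    ring
  rw [hy2, argF]
  field_simp
  ring

lemma hasDerivAt_funG' (h1 : 1 < s) (h4 : s < 4) :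
    HasDerivAt funG' (-((7 * s - 4) / (6 * s * (s - 1))) * funG' s -
      (s - 4) / (144 * s ^ 2 * (s - 1)) * funG s) s := by
  have hs : s ≠ 0 := by positivity
  have hs1 : s - 1 ≠ 0 := by linarith
  have hs2 : s + 8 ≠ 0 := by positivity
  have hs4 : 4 - s ≠ 0 := by linarith
  have hz : argG s ≠ 0 := by
    rw [argG]
    positivity
  have ode := hyp_evalAt_ode (a := 1 / 12) (b := 1 / 12) (c := 1 / 2) (by norm_num) (by norm_num)
    (by norm_num) (abs_argG_lt h1.le h4) hz
  refine (((convOnUnit_hypG.derivative.hasDerivAt (abs_argG_lt h1.le h4)).comp s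
    (hasDerivAt_argG hs)).mul (hasDerivAt_deriv_argG hs)).congr_deriv ?_
  rw [funG', funG, Function.comp]
  generalize evalAt (derivative ℝ (derivative ℝ hypG)) (argG s) = y2 at *
  generalize evalAt (derivative ℝ hypG) (argG s) = y1 at *
  generalize evalAt hypG (argG s) = y0 at *
  have hy2 : y2 = (((1 / 12 + 1 / 12 + 1) * argG s - 1 / 2) * y1 + 1 / 12 * (1 / 12) * y0) /
      ((s - 1) * (s + 8) ^ 2 / (27 * s ^ 2) * ((4 - s) ^ 3 / (27 * s ^ 2))) := by
    rw [eq_div_iff (by positivity), ← ode, one_sub_argG h1.le, argG]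
    ring
  rw [hy2, argG]
  field_simp
  ring

lemma funG_pos (h1 : 1 ≤ s) (h4 : s < 4) : 0 < funG s :=
  evalAt_pos convOnUnit_hypG (fun n => coeff_hyp_pos (by norm_num) (by norm_num) (by norm_num) n)
    (argG_nonneg h1) (argG_lt_one h1 h4)

/-- The Wronskian of `funF` and `s ^ (-1/24) * funG` vanishes. -/
lemma wronskian_eq_zero (h1 : 1 < s) (h4 : s < 4) :
    funF s * (funG' s - funG s / (24 * s)) - funF' s * funG s = 0 := by
  set W : ℝ → ℝ := fun s => funF s * (funG' s - funG s / (24 * s)) - funF' s * funG s with hW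
  have hcont : ContinuousOn (fun s => W s ^ 24 * ((s - 1) ^ 12 * s ^ 17)) (Set.Ico 1 4) := by
    intro t ht
    have ht0 : 24 * t ≠ 0 := by linarith [ht.1]
    have c1 := (hasDerivAt_funF ht.1 ht.2.le).continuousAt
    have c2 := (hasDerivAt_funG ht.1 ht.2).continuousAt
    have c3 := (differentiableAt_funF' ht.1 ht.2.le).continuousAt
    have c4 := (differentiableAt_funG' ht.1 ht.2).continuousAt
    refine ContinuousAt.continuousWithinAt ?_
    exact (((c1.mul (c4.sub (c2.div (by fun_prop) ht0))).sub (c3.mul c2)).pow 24).mul (by fun_prop)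
  have hder : ∀ t ∈ interior (Set.Ico (1 : ℝ) 4),
      HasDerivAt (fun s => W s ^ 24 * ((s - 1) ^ 12 * s ^ 17)) 0 t := by
    intro t ht
    rw [interior_Ico] at ht
    obtain ⟨ht1, ht4⟩ := ht
    have ht0 : t ≠ 0 := by positivity
    have ht1' : t - 1 ≠ 0 := by linarith
    have d1 := hasDerivAt_funF ht1.le ht4.le
    have d2 := hasDerivAt_funG ht1.le ht4
    have d3 := hasDerivAt_funF' ht1 ht4
    have d4 := hasDerivAt_funG' ht1 ht4
    have dW : HasDerivAt W (-(17 / (24 * t) + 1 / (2 * (t - 1))) * W t) t := by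
      refine ((d1.mul (d4.sub (d2.div ((hasDerivAt_id t).const_mul 24) (by simpa using ht0)))).sub
        (d3.mul d2)).congr_deriv ?_
      simp only [hW, id, Pi.sub_apply, Pi.div_apply]
      field_simp
      ring
    refine ((dW.pow 24).mul ((((hasDerivAt_id t).sub_const 1).pow 12).mul
      ((hasDerivAt_id t).pow 17))).congr_deriv ?_
    simp
    field_simp
    ring
  have := eq_of_hasDerivAt_zero (convex_Ico 1 4) hcont hder (x := s) (y := 1) ⟨h1.le, h4⟩
    (by norm_num)
  have hs : (s - 1) ^ 12 * s ^ 17 ≠ 0 := by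
    have : 0 < s - 1 := by linarith
    positivity
  simpa [hs] using this

/-- The transformation between `₂F₁(1/8, 1/8; 3/4; ·)` and `₂F₁(1/12, 1/12; 1/2; ·)`. -/
theorem funF_eq (h1 : 1 ≤ s) (h4 : s < 4) : funF s = s ^ (-(1 / 24) : ℝ) * funG s := by
  have hdiff : ∀ t ∈ Set.Ico (1 : ℝ) 4,
      HasDerivAt (fun t => funF t / (t ^ (-(1 / 24) : ℝ) * funG t))
      ((funF' t * (t ^ (-(1 / 24) : ℝ) * funG t) - funF t * (-(1 / 24) * t ^ (-(1 / 24) - 1 : ℝ) *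
        funG t + t ^ (-(1 / 24) : ℝ) * funG' t)) / (t ^ (-(1 / 24) : ℝ) * funG t) ^ 2) t := by
    intro t ht
    have ht0 : 0 < t := by linarith [ht.1]
    exact (hasDerivAt_funF ht.1 ht.2.le).div
      ((Real.hasDerivAt_rpow_const (Or.inl ht0.ne')).mul (hasDerivAt_funG ht.1 ht.2))
      (mul_pos (by positivity) (funG_pos ht.1 ht.2)).ne'
  have key := eq_of_hasDerivAt_zero (convex_Ico 1 4)
    (fun t ht => (hdiff t ht).continuousAt.continuousWithinAt)
    (fun t ht => by
      refine (hdiff t (interior_subset ht)).congr_deriv ?_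
      rw [interior_Ico] at ht
      have hW := wronskian_eq_zero ht.1 ht.2
      have ht0 : 0 < t := by linarith [ht.1]
      have e : t ^ (-(1 / 24) - 1 : ℝ) = t ^ (-(1 / 24) : ℝ) / t := Real.rpow_sub_one ht0.ne' _
      rw [div_eq_zero_iff, e]
      left
      linear_combination -t ^ (-(1 / 24) : ℝ) * hW)
    (x := s) (y := 1) ⟨h1, h4⟩ (by norm_num)
  have e1 : funF 1 = 1 := by
    simp [funF, argF, evalAt_zero, -PowerSeries.coeff_zero_eq_constantCoeff, coeff_hyp, poch_zero]
  have e2 : funG 1 = 1 := by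
    simp [funG, argG, evalAt_zero, -PowerSeries.coeff_zero_eq_constantCoeff, coeff_hyp, poch_zero]
  rw [e1, e2, Real.one_rpow, mul_one, div_one,
    div_eq_one_iff_eq (mul_pos (by positivity) (funG_pos h1 h4)).ne'] at key
  exact key

lemma funF'_eq (h1 : 1 < s) (h4 : s < 4) :
    funF' s = s ^ (-(1 / 24) : ℝ) * (funG' s - funG s / (24 * s)) := by
  have hW := wronskian_eq_zero h1 h4
  rw [funF_eq h1.le h4] at hW
  refine mul_right_cancel₀ (funG_pos h1.le h4).ne' ?_
  linear_combination -hW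

end Transformation

/-! ### Boundary values at `1` -/

lemma tendsto_evalAt_hyp_one {a : ℝ} (ha : 0 < a) :
    Tendsto (evalAt (hyp a 1 1)) (nhdsWithin 1 (Set.Iio 1)) atTop := by
  have h1 : Tendsto (fun x : ℝ => 1 - x) (nhdsWithin 1 (Set.Iio 1)) (nhdsWithin 0 (Set.Ioi 0)) := by
    refine tendsto_nhdsWithin_iff.2 ⟨?_, ?_⟩
    · have : Tendsto (fun x : ℝ => 1 - x) (nhds 1) (nhds (1 - 1)) := tendsto_id.const_sub 1
      rw [sub_self] at this
      exact this.mono_left nhdsWithin_le_nhds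
    · filter_upwards [self_mem_nhdsWithin] with x hx using sub_pos.2 (Set.mem_Iio.1 hx)
  refine ((tendsto_rpow_neg_nhdsGT_zero (neg_lt_zero.2 ha)).comp h1).congr' ?_
  filter_upwards [self_mem_nhdsWithin, nhdsWithin_le_nhds (Ioi_mem_nhds (zero_lt_one' ℝ))]
    with x hx1 hx0
  exact (evalAt_hyp_one ha (by rwa [abs_of_pos hx0])).symm

lemma coeff_hyp_div_coeff_hyp_one {a b c d : ℝ} (hc : 0 < c) (hd : 0 < d) (n : ℕ) :
    coeff n (hyp a b c) / coeff n (hyp d 1 1) = poch a n * poch b n / (poch c n * poch d n) := by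
  have := poch_pos hc n
  have := poch_pos hd n
  rw [coeff_hyp, coeff_hyp, poch_one]
  field_simp

/-- Gauss's evaluation of `₂F₁(a, b; c; 1)`. -/
theorem tendsto_evalAt_hyp {a b c : ℝ} (ha : 0 < a) (hb : 0 < b) (hac : a < c) (hbc : b < c)
    (habc : 0 < c - a - b) :
    Tendsto (evalAt (hyp a b c)) (nhdsWithin 1 (Set.Iio 1))
      (nhds (Real.Gamma c * Real.Gamma (c - a - b) /
        (Real.Gamma (c - a) * Real.Gamma (c - b)))) := by
  have hc : 0 < c := ha.trans hac
  have hB := convOnUnit_hyp habc one_pos one_pos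
  refine (tendsto_evalAt_div (convOnUnit_hyp (sub_pos.2 hac) (sub_pos.2 hbc) hc) hB
    (coeff_hyp_pos habc one_pos one_pos)
    ((tendsto_poch_ratio (sub_pos.2 hac) (sub_pos.2 hbc) hc habc (by ring)).congr
      fun n => (coeff_hyp_div_coeff_hyp_one hc habc n).symm)
    (tendsto_evalAt_hyp_one habc)).congr' ?_
  filter_upwards [self_mem_nhdsWithin, nhdsWithin_le_nhds (Ioi_mem_nhds (zero_lt_one' ℝ))]
    with x hx1 hx0
  have hx1 : x < 1 := hx1
  have hx0 : 0 < x := hx0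
  rw [← hyp_euler hc, ConvOnUnit.evalAt_mul hB (convOnUnit_hyp ha hb hc)
    (by rwa [abs_of_pos hx0]), mul_div_cancel_left₀]
  exact (evalAt_pos hB (coeff_hyp_pos habc one_pos one_pos) hx0.le hx1).ne'

lemma tendsto_evalAt_derivative_hypG :
    Tendsto (fun x => evalAt (derivative ℝ hypG) x / evalAt (hyp (2 / 3) 1 1) x)
      (nhdsWithin 1 (Set.Iio 1))
      (nhds (Real.Gamma (1 / 2) * Real.Gamma (2 / 3) / Real.Gamma (1 / 12) ^ 2)) := by
  refine tendsto_evalAt_div convOnUnit_hypG.derivative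
    (convOnUnit_hyp (by norm_num) one_pos one_pos)
    (coeff_hyp_pos (by norm_num) one_pos one_pos) ?_ (tendsto_evalAt_hyp_one (by norm_num))
  have h := (tendsto_poch_ratio (a := 13 / 12) (b := 13 / 12) (c := 3 / 2) (d := 2 / 3)
    (by norm_num) (by norm_num) (by norm_num) (by norm_num) (by norm_num)).const_mul (1 / 72)
  have g1 : Real.Gamma (13 / 12) = 1 / 12 * Real.Gamma (1 / 12) := by
    rw [← Real.Gamma_add_one (by norm_num)]; norm_num
  have g2 : Real.Gamma (3 / 2) = 1 / 2 * Real.Gamma (1 / 2) := by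
    rw [← Real.Gamma_add_one (by norm_num)]; norm_num
  have e : 1 / 72 * (Real.Gamma (3 / 2) * Real.Gamma (2 / 3) /
      (Real.Gamma (13 / 12) * Real.Gamma (13 / 12))) =
      Real.Gamma (1 / 2) * Real.Gamma (2 / 3) / Real.Gamma (1 / 12) ^ 2 := by
    have := Real.Gamma_pos_of_pos (show (0 : ℝ) < 1 / 12 by norm_num)
    rw [g1, g2]
    field_simp
    norm_num
  rw [e] at h
  refine h.congr fun n => ?_
  have := poch_pos (show (0 : ℝ) < 3 / 2 by norm_num) n
  have := poch_pos (show (0 : ℝ) < 2 / 3 by norm_num) n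
  rw [PowerSeries.coeff_derivative, coeff_hyp, coeff_hyp, poch_one, poch_succ_left,
    poch_succ_left, Nat.factorial_succ, show (1 / 12 + 1 : ℝ) = 13 / 12 by norm_num,
    show (1 / 2 + 1 : ℝ) = 3 / 2 by norm_num]
  push_cast
  field_simp
  ring

/-! ### Values of the transformation at `4` -/

lemma tendsto_argG :
    Tendsto argG (nhdsWithin 4 (Set.Iio 4)) (nhdsWithin 1 (Set.Iio 1)) := by
  refine tendsto_nhdsWithin_iff.2 ⟨?_, ?_⟩
  · have h := (hasDerivAt_argG (four_ne_zero (α := ℝ))).continuousAt.tendsto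
    rw [show argG 4 = 1 by norm_num [argG]] at h
    exact h.mono_left nhdsWithin_le_nhds
  · filter_upwards [self_mem_nhdsWithin, nhdsWithin_le_nhds (Ioi_mem_nhds (show (1 : ℝ) < 4 by
      norm_num))] with s h4 h1
    exact argG_lt_one (le_of_lt h1) h4

lemma tendsto_funG :
    Tendsto funG (nhdsWithin 4 (Set.Iio 4))
      (nhds (Real.Gamma (1 / 2) * Real.Gamma (1 / 3) / Real.Gamma (5 / 12) ^ 2)) := by
  have h := (tendsto_evalAt_hyp (a := 1 / 12) (b := 1 / 12) (c := 1 / 2) (by norm_num)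
    (by norm_num) (by norm_num) (by norm_num) (by norm_num)).comp tendsto_argG
  norm_num at h
  rw [← pow_two] at h
  norm_num
  exact h

lemma funG'_eq {s : ℝ} (h1 : 1 < s) (h4 : s < 4) :
    funG' s = evalAt (derivative ℝ hypG) (argG s) / evalAt (hyp (2 / 3) 1 1) (argG s) *
      ((s + 8) * s ^ (4 / 3 : ℝ) / (3 * s ^ 3)) := by
  have hs : 0 < s := by linarith
  have h4' : 0 < 4 - s := by linarith
  have e : (1 - argG s) ^ (-(2 / 3) : ℝ) = 9 * s ^ (4 / 3 : ℝ) / (4 - s) ^ 2 := by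
    rw [one_sub_argG h1.le, Real.rpow_neg (by positivity), Real.div_rpow (by positivity)
      (by positivity), Real.mul_rpow (by norm_num) (by positivity), inv_div,
      ← Real.rpow_natCast_mul h4'.le, ← Real.rpow_natCast_mul hs.le,
      show (27 : ℝ) = 3 ^ 3 by norm_num, ← Real.rpow_natCast_mul (by norm_num : (0 : ℝ) ≤ 3),
      ← Real.rpow_natCast (4 - s) 2]
    norm_num
  have hp : 0 < s ^ (4 / 3 : ℝ) := by positivity
  rw [evalAt_hyp_one (by norm_num) (abs_argG_lt h1.le h4), e, funG']
  field_simp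
  ring

lemma tendsto_funG' :
    Tendsto funG' (nhdsWithin 4 (Set.Iio 4))
      (nhds (Real.Gamma (1 / 2) * Real.Gamma (2 / 3) / Real.Gamma (1 / 12) ^ 2 *
        ((4 : ℝ) ^ (4 / 3 : ℝ) / 16))) := by
  have h2 : ContinuousAt (fun s : ℝ => (s + 8) * s ^ (4 / 3 : ℝ) / (3 * s ^ 3)) 4 :=
    ((by fun_prop : ContinuousAt (fun s : ℝ => s + 8) 4).mul
      (Real.continuousAt_rpow_const 4 _ (Or.inl four_ne_zero))).div (by fun_prop) (by norm_num)
  have h3 := h2.tendsto.mono_left (nhdsWithin_le_nhds (s := Set.Iio 4))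
  rw [show ((4 : ℝ) + 8) * 4 ^ (4 / 3 : ℝ) / (3 * 4 ^ 3) = 4 ^ (4 / 3 : ℝ) / 16 by ring] at h3
  refine ((tendsto_evalAt_derivative_hypG.comp tendsto_argG).mul h3).congr' ?_
  filter_upwards [self_mem_nhdsWithin, nhdsWithin_le_nhds (Ioi_mem_nhds (show (1 : ℝ) < 4 by
      norm_num))] with s h4 h1
  exact (funG'_eq h1 h4).symm

lemma tendsto_rpow_four :
    Tendsto (fun s : ℝ => s ^ (-(1 / 24) : ℝ)) (nhdsWithin 4 (Set.Iio 4))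
      (nhds (4 ^ (-(1 / 24) : ℝ))) :=
  (Real.continuousAt_rpow_const 4 _ (Or.inl four_ne_zero)).tendsto.mono_left nhdsWithin_le_nhds

lemma funF_four :
    funF 4 = 4 ^ (-(1 / 24) : ℝ) *
      (Real.Gamma (1 / 2) * Real.Gamma (1 / 3) / Real.Gamma (5 / 12) ^ 2) := by
  refine tendsto_nhds_unique ((hasDerivAt_funF (s := 4) (by norm_num)
    le_rfl).continuousAt.tendsto.mono_left (nhdsWithin_le_nhds (s := Set.Iio 4)))
    ((tendsto_rpow_four.mul tendsto_funG).congr' ?_)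
  filter_upwards [self_mem_nhdsWithin, nhdsWithin_le_nhds (Ioi_mem_nhds (show (1 : ℝ) < 4 by
      norm_num))] with s h4 h1
  exact (funF_eq (le_of_lt h1) h4).symm

lemma funF_four_add :
    funF 4 + 96 * funF' 4 = 4 ^ (-(1 / 24) : ℝ) * (6 * 4 ^ (4 / 3 : ℝ) *
      (Real.Gamma (1 / 2) * Real.Gamma (2 / 3) / Real.Gamma (1 / 12) ^ 2)) := by
  have hdiv : Tendsto (fun s : ℝ => 24 * s) (nhdsWithin 4 (Set.Iio 4)) (nhds (24 * 4)) :=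
    ((continuous_const_mul 24).tendsto 4).mono_left nhdsWithin_le_nhds
  have h : funF' 4 = _ := tendsto_nhds_unique ((differentiableAt_funF' (s := 4) (by norm_num)
    le_rfl).continuousAt.tendsto.mono_left (nhdsWithin_le_nhds (s := Set.Iio 4)))
    ((tendsto_rpow_four.mul (tendsto_funG'.sub (tendsto_funG.div hdiv (by norm_num)))).congr' <| by
      filter_upwards [self_mem_nhdsWithin, nhdsWithin_le_nhds (Ioi_mem_nhds (show (1 : ℝ) < 4 by
        norm_num))] with s h4 h1
      exact (funF'_eq h1 h4).symm)
  rw [h, funF_four]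
  ring

lemma Gamma_product :
    (Real.Gamma (1 / 2) * Real.Gamma (1 / 3) / Real.Gamma (5 / 12) ^ 2) *
      (Real.Gamma (1 / 2) * Real.Gamma (2 / 3) / Real.Gamma (1 / 12) ^ 2) =
      π ^ 2 / (3 * Real.Gamma (1 / 4) ^ 4) := by
  have h3 := Gamma_mul_three (s := 1 / 12) (by norm_num)
  have hP := Real.Gamma_mul_Gamma_one_sub (1 / 3)
  have hQ := Real.Gamma_mul_Gamma_one_sub (1 / 4)
  rw [show π * (1 / 3) = π / 3 by ring, Real.sin_pi_div_three] at hP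
  rw [show π * (1 / 4) = π / 4 by ring, Real.sin_pi_div_four] at hQ
  rw [show (1 : ℝ) - 1 / 3 = 2 / 3 by norm_num] at hP
  rw [show (1 : ℝ) - 1 / 4 = 3 / 4 by norm_num] at hQ
  rw [show (1 / 12 + 1 / 3 : ℝ) = 5 / 12 by norm_num, show (1 / 12 + 2 / 3 : ℝ) = 3 / 4 by norm_num,
    show (3 * (1 / 12) : ℝ) = 1 / 4 by norm_num, hP] at h3
  have hr : ((3 : ℝ) ^ (1 - 1 / 4 : ℝ)) ^ 2 = 3 * √3 := by
    rw [← Real.rpow_mul_natCast (by norm_num), Real.sqrt_eq_rpow,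
      ← Real.rpow_one_add' (by norm_num) (by norm_num)]
    norm_num
  have h2 : √2 ^ 2 = 2 := Real.sq_sqrt (by norm_num)
  have hπ : √π ^ 2 = π := Real.sq_sqrt Real.pi_pos.le
  have p1 := Real.Gamma_pos_of_pos (show (0 : ℝ) < 1 / 12 by norm_num)
  have p5 := Real.Gamma_pos_of_pos (show (0 : ℝ) < 5 / 12 by norm_num)
  have p4 := Real.Gamma_pos_of_pos (show (0 : ℝ) < 1 / 4 by norm_num)
  have p9 := Real.Gamma_pos_of_pos (show (0 : ℝ) < 3 / 4 by norm_num)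
  have hpi := Real.pi_pos
  have s2 : 0 < √2 := by positivity
  have s3 : 0 < √3 := by positivity
  rw [Real.Gamma_one_half_eq]
  generalize Real.Gamma (1 / 12) = A at *
  generalize Real.Gamma (5 / 12) = B at *
  generalize Real.Gamma (1 / 4) = D at *
  generalize Real.Gamma (3 / 4) = E at *
  generalize Real.Gamma (1 / 3) = U at *
  generalize Real.Gamma (2 / 3) = V at *
  have hE : E = π / (√2 / 2) / D := by rw [eq_div_iff p4.ne', ← hQ]; ring
  have hAB : (A * B) ^ 2 * E ^ 2 = 3 * √3 * (π / (√3 / 2)) ^ 2 * D ^ 2 := by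
    rw [← hr, ← mul_pow, h3]; ring
  have hAB' : (A * B) ^ 2 = 3 * √3 * (π / (√3 / 2)) ^ 2 * D ^ 2 / E ^ 2 := by
    rw [eq_div_iff (by positivity), hAB]
  have : √π * U / B ^ 2 * (√π * V / A ^ 2) = √π ^ 2 * (U * V) / (A * B) ^ 2 := by
    field_simp
  rw [this, hπ, hP, hAB', hE]
  field_simp
  rw [h2]

/-- The coefficients of the power series `∑ (1/4)_n ^ 4 / (4n)! * 256 ^ n * (1 + 20 n) * X ^ n`. -/
lemma coeff_series (n : ℕ) :
    coeff n (hypF * hypF + C 20 * theta (hypF * hypF)) =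
      poch (1 / 4) n ^ 4 * 256 ^ n / (4 * n).factorial * (1 + 20 * n) := by
  rw [map_add, PowerSeries.coeff_C_mul, coeff_theta, coeff_hyp_sq]
  ring

lemma evalAt_series {x : ℝ} (hx : |x| < 1) :
    evalAt (hypF * hypF + C 20 * theta (hypF * hypF)) x =
      evalAt hypF x * (evalAt hypF x + 40 * x * evalAt (derivative ℝ hypF) x) := by
  have hF := convOnUnit_hypF
  have hT : ConvOnUnit (theta hypF) := hF.derivative.X_mul
  have h2 : C 20 * theta (hypF * hypF) = C 40 * (hypF * theta hypF) := by
    rw [theta_mul, show (C 40 : ℝ⟦X⟧) = C 20 * C 2 by rw [← map_mul]; norm_num,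
      show (C 2 : ℝ⟦X⟧) = 2 from map_ofNat C 2]
    ring
  rw [h2, ConvOnUnit.evalAt_add (hF.mul hF) ((hF.mul hT).C_mul 40) hx, evalAt_C_mul,
    ConvOnUnit.evalAt_mul hF hF hx, ConvOnUnit.evalAt_mul hF hT hx, theta,
    ConvOnUnit.evalAt_X_mul _ hF.derivative hx]
  ring

theorem stmt19 :
    Tendsto (fun N => ∑ n ∈ Finset.range N,
      (poch (1 / 4) n ^ 4 / ((4 * n).factorial : ℝ)) * (-144) ^ n * (1 + 20 * (n : ℝ)))
      atTop (nhds (8 * Real.sqrt 2 * π ^ 2 / Real.Gamma (1 / 4) ^ 4)) := by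
  have hx : |argF 4| < 1 := abs_argF_lt (by norm_num) le_rfl
  have hF2 := convOnUnit_hypF.mul convOnUnit_hypF
  have hsum := (((hF2.add (hF2.derivative.X_mul.C_mul 20)).summable
    hx).hasSum.tendsto_sum_nat)
  have hval : evalAt (hypF * hypF + C 20 * theta (hypF * hypF)) (argF 4) =
      8 * √2 * π ^ 2 / Real.Gamma (1 / 4) ^ 4 := by
    have e : (4 : ℝ) ^ (-(1 / 24) : ℝ) * 4 ^ (-(1 / 24) : ℝ) * 4 ^ (4 / 3 : ℝ) = 4 * √2 := by
      have : √2 = (4 : ℝ) ^ (1 / 4 : ℝ) := by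
        rw [Real.sqrt_eq_rpow, show (4 : ℝ) = 2 ^ 2 by norm_num,
          ← Real.rpow_natCast_mul (by norm_num)]
        norm_num
      rw [this, ← Real.rpow_one_add' (by norm_num) (by norm_num), ← Real.rpow_add (by norm_num),
        ← Real.rpow_add (by norm_num)]
      norm_num
    have h96 : 40 * argF 4 * evalAt (derivative ℝ hypF) (argF 4) = 96 * funF' 4 := by
      rw [funF', show 40 * argF 4 = 96 * (-((4 ^ 2 - 1) / (4 * 4 ^ 2))) by norm_num [argF]]
      ring
    rw [evalAt_series hx, h96, ← funF, funF_four_add, funF_four]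
    calc _ = 6 * ((4 : ℝ) ^ (-(1 / 24) : ℝ) * 4 ^ (-(1 / 24) : ℝ) * 4 ^ (4 / 3 : ℝ)) *
          ((Real.Gamma (1 / 2) * Real.Gamma (1 / 3) / Real.Gamma (5 / 12) ^ 2) *
          (Real.Gamma (1 / 2) * Real.Gamma (2 / 3) / Real.Gamma (1 / 12) ^ 2)) := by ring
      _ = _ := by
        rw [e, Gamma_product]
        field_simp
        norm_num
  rw [← hval]
  refine hsum.congr fun N => Finset.sum_congr rfl fun n _ => ?_
  rw [← theta, coeff_series, show (-144 : ℝ) = 256 * argF 4 by norm_num [argF], mul_pow]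
  ring
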